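/- Let m ≥ n ≥ 1 and r ≥ 1 be integers, let μ₀ > 0, ϱ > 0, Σ_max ≥ 0, and let Ω ⊆ {1,…,m}×{1,…,n}. Let U ∈ ℝ^{m×r} with UᵀU = m·I_r and V ∈ ℝ^{n×r} with VᵀV = n·I_r, whose rows satisfy ‖U^{(i)}‖² ≤ 3μ₀r for all i and ‖V^{(j)}‖² ≤ 3μ₀r for all j, let Σ ∈ ℝ^{r×r} be diagonal with diagonal entries bounded in absolute value by Σ_max, and set M = UΣVᵀ. Define, for W ∈ ℝ^{m×r} and Z ∈ ℝ^{n×r}, F(W,Z) = inf_{S ∈ ℝ^{r×r}} (1/2)·‖P_Ω(M − WSZᵀ)‖_F² and F̃(W,Z) = F(W,Z) + ϱ·Σ_{i=1}^m G₁(‖W^{(i)}‖²/(3μ₀r)) + ϱ·Σ_{j=1}^n G₁(‖Z^{(j)}‖²/(3μ₀r)). Then for every W ∈ ℝ^{m×r} with WᵀW = m·I_r whose rows satisfy ‖W^{(i)}‖² ≤ 4μ₀r and every Z ∈ ℝ^{n×r} with ZᵀZ = n·I_r whose rows satisfy ‖Z^{(j)}‖² ≤ 4μ₀r, one has F̃(W,Z)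 ≤ (m·Σ_max² + (14·e^{1/9}/(9μ₀r))·ϱ)·(‖U − W‖_F² + ‖V − Z‖_F²). -/

import Mathlib

open Matrix

/-- Frobenius norm of a real matrix. -/
noncomputable def frobNorm {m n : ℕ} (A : Matrix (Fin m) (Fin n) ℝ) : ℝ :=
  Real.sqrt (∑ i, ∑ j, (A i j) ^ 2)

/-- The penalty function `G₁`. -/
noncomputable def G1 (z : ℝ) : ℝ := if z ≤ 1 then 0 else Real.exp ((z - 1) ^ 2) - 1

/-- Entrywise projection onto the observed index set `Ω`. -/
def projOmega {m n : ℕ} (Ω : Finset (Fin m × Fin n)) (A : Matrix (Fin m) (Fin n) ℝ) :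
    Matrix (Fin m) (Fin n) ℝ :=
  Matrix.of fun i j => if (i, j) ∈ Ω then A i j else 0

theorem frobNorm_sq {m n : ℕ} (A : Matrix (Fin m) (Fin n) ℝ) :
    frobNorm A ^ 2 = ∑ i, ∑ j, (A i j) ^ 2 :=
  Real.sq_sqrt (Finset.sum_nonneg fun _ _ => Finset.sum_nonneg fun _ _ => sq_nonneg _)

theorem frobNorm_sq_eq_trace {m n : ℕ} (A : Matrix (Fin m) (Fin n) ℝ) :
    frobNorm A ^ 2 = (A * Aᵀ).trace := by
  rw [frobNorm_sq]
  simp [Matrix.trace, Matrix.mul_apply, sq]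

theorem frobNorm_transpose {m n : ℕ} (A : Matrix (Fin m) (Fin n) ℝ) :
    frobNorm Aᵀ = frobNorm A := by
  unfold frobNorm
  rw [Finset.sum_comm]
  rfl

/-- Multiplying by the transpose of a matrix with orthogonal columns of squared length `c`
scales the squared Frobenius norm by `c`. -/
theorem frobNorm_mul_transpose_sq {m n r : ℕ} (A : Matrix (Fin m) (Fin r) ℝ)
    (B : Matrix (Fin n) (Fin r) ℝ) {c : ℝ} (hB : Bᵀ * B = c • 1) :
    frobNorm (A * Bᵀ) ^ 2 = c * frobNorm A ^ 2 := by
  have h : A * Bᵀ * (A * Bᵀ)ᵀ = c • (A * Aᵀ) := by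
    rw [transpose_mul, transpose_transpose, Matrix.mul_assoc, ← Matrix.mul_assoc Bᵀ, hB]
    simp
  rw [frobNorm_sq_eq_trace, frobNorm_sq_eq_trace, h, trace_smul, smul_eq_mul]

theorem frobNorm_mul_diag_sq_le {m r : ℕ} (A : Matrix (Fin m) (Fin r) ℝ)
    {S : Matrix (Fin r) (Fin r) ℝ} (hS : S.IsDiag) {s : ℝ} (hs : ∀ i, |S i i| ≤ s) :
    frobNorm (A * S) ^ 2 ≤ s ^ 2 * frobNorm A ^ 2 := by
  rw [frobNorm_sq, frobNorm_sq, Finset.mul_sum]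
  refine Finset.sum_le_sum fun i _ => ?_
  rw [Finset.mul_sum]
  refine Finset.sum_le_sum fun j _ => ?_
  have h : (A * S) i j = A i j * S j j := by
    rw [← hS.diagonal_diag, mul_diagonal]
    simp
  rw [h, mul_pow, mul_comm]
  exact mul_le_mul_of_nonneg_right (sq_le_sq' (abs_le.1 (hs j)).1 (abs_le.1 (hs j)).2)
    (sq_nonneg _)

theorem frobNorm_add_sq_le {m n : ℕ} (A B : Matrix (Fin m) (Fin n) ℝ) :
    frobNorm (A + B) ^ 2 ≤ 2 * (frobNorm A ^ 2 + frobNorm B ^ 2) := by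
  simp only [frobNorm_sq, ← Finset.sum_add_distrib, Finset.mul_sum, Matrix.add_apply]
  exact Finset.sum_le_sum fun i _ => Finset.sum_le_sum fun j _ => add_sq_le

theorem frobNorm_projOmega_sq_le {m n : ℕ} (Ω : Finset (Fin m × Fin n))
    (A : Matrix (Fin m) (Fin n) ℝ) : frobNorm (projOmega Ω A) ^ 2 ≤ frobNorm A ^ 2 := by
  rw [frobNorm_sq, frobNorm_sq]
  refine Finset.sum_le_sum fun i _ => Finset.sum_le_sum fun j _ => ?_
  rw [projOmega, of_apply]
  split_ifs
  · exact le_rfl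
  · simpa using sq_nonneg (A i j)

/-- Perturbation bound for a product `U S Vᵀ` with diagonal `S` when both outer factors change. -/
theorem frobNorm_factor_sub_sq_le {m n r : ℕ} (hmn : n ≤ m)
    {U W : Matrix (Fin m) (Fin r) ℝ} {V Z : Matrix (Fin n) (Fin r) ℝ}
    (hV : Vᵀ * V = (n : ℝ) • 1) (hW : Wᵀ * W = (m : ℝ) • 1)
    {S : Matrix (Fin r) (Fin r) ℝ} (hS : S.IsDiag) {s : ℝ} (hs : ∀ i, |S i i| ≤ s) :
    (1 / 2) * frobNorm (U * S * Vᵀ - W * S * Zᵀ) ^ 2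
      ≤ m * s ^ 2 * (frobNorm (U - W) ^ 2 + frobNorm (V - Z) ^ 2) := by
  have split : U * S * Vᵀ - W * S * Zᵀ = (U - W) * S * Vᵀ + ((V - Z) * Sᵀ * Wᵀ)ᵀ := by
    simp only [transpose_mul, transpose_transpose, transpose_sub, Matrix.sub_mul,
      Matrix.mul_assoc]
    abel
  have hadd := frobNorm_add_sq_le ((U - W) * S * Vᵀ) ((V - Z) * Sᵀ * Wᵀ)ᵀ
  rw [← split, frobNorm_transpose, frobNorm_mul_transpose_sq _ _ hV,
    frobNorm_mul_transpose_sq _ _ hW] at hadd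
  have hUW := frobNorm_mul_diag_sq_le (U - W) hS hs
  have hVZ := frobNorm_mul_diag_sq_le (V - Z) hS.transpose hs
  have hnm : (n : ℝ) ≤ m := by exact_mod_cast hmn
  have hleft := mul_le_mul hnm hUW (sq_nonneg _) m.cast_nonneg
  have hright := mul_le_mul_of_nonneg_left hVZ (m.cast_nonneg (α := ℝ))
  linarith

theorem G1_le_of_le {z : ℝ} (hz : z ≤ 4 / 3) : G1 z ≤ Real.exp (1 / 9) * (max (z - 1) 0) ^ 2 := by
  unfold G1
  split_ifs with h
  · positivity
  · rw [max_eq_left (by linarith)]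
    have hsq : (z - 1) ^ 2 ≤ 1 / 9 := by nlinarith
    have hexp : Real.exp ((z - 1) ^ 2) - 1 ≤ (z - 1) ^ 2 * Real.exp ((z - 1) ^ 2) := by
      have hneg := Real.add_one_le_exp (-(z - 1) ^ 2)
      have hmul := mul_le_mul_of_nonneg_right hneg (Real.exp_pos ((z - 1) ^ 2)).le
      rw [← Real.exp_add, neg_add_cancel, Real.exp_zero] at hmul
      linarith
    have hmono := mul_le_mul_of_nonneg_left (Real.exp_le_exp.2 hsq) (sq_nonneg (z - 1))
    linarith

/-- If `‖u‖² ≤ a` and `‖w‖² ≤ 4a/3`, the excess of `‖w‖²` over `a` is controlled by `‖u - w‖`. -/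
theorem sq_max_div_sub_one_le {r : ℕ} {u w : Fin r → ℝ} {a : ℝ} (ha : 0 < a)
    (hu : ∑ k, u k ^ 2 ≤ a) (hw : ∑ k, w k ^ 2 ≤ 4 / 3 * a) :
    (max ((∑ k, w k ^ 2) / a - 1) 0) ^ 2 ≤ 14 / (3 * a) * ∑ k, (u k - w k) ^ 2 := by
  have hd : 0 ≤ ∑ k, (u k - w k) ^ 2 := Finset.sum_nonneg fun _ _ => sq_nonneg _
  rcases le_total ((∑ k, w k ^ 2) / a - 1) 0 with h | h
  · rw [max_eq_right h, zero_pow two_ne_zero]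
    positivity
  rw [max_eq_left h]
  have hexcess : 0 ≤ ∑ k, w k ^ 2 - a := by
    rw [sub_nonneg, one_le_div ha] at h
    linarith
  have hcauchy := Finset.sum_mul_sq_le_sq_mul_sq Finset.univ (fun k => u k - w k)
    (fun k => u k + w k)
  have hprod : ∑ k, (u k - w k) * (u k + w k) = ∑ k, u k ^ 2 - ∑ k, w k ^ 2 := by
    rw [← Finset.sum_sub_distrib]
    exact Finset.sum_congr rfl fun _ _ => by ring
  have hsum : ∑ k, (u k + w k) ^ 2 ≤ 13 / 6 * ∑ k, u k ^ 2 + 13 / 7 * ∑ k, w k ^ 2 := by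
    rw [Finset.mul_sum, Finset.mul_sum, ← Finset.sum_add_distrib]
    exact Finset.sum_le_sum fun k _ => by nlinarith [sq_nonneg (7 * u k - 6 * w k)]
  have hsum_le : ∑ k, (u k + w k) ^ 2 ≤ 14 / 3 * a := by linarith
  rw [hprod] at hcauchy
  have hbound := mul_le_mul_of_nonneg_left hsum_le hd
  have hsq : (∑ k, w k ^ 2 - a) ^ 2 ≤ (∑ k, u k ^ 2 - ∑ k, w k ^ 2) ^ 2 := by
    rw [← neg_sq (∑ k, u k ^ 2 - ∑ k, w k ^ 2)]
    exact pow_le_pow_left₀ hexcess (by linarith) 2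
  rw [div_sub_one ha.ne', div_pow, div_le_iff₀ (by positivity)]
  calc (∑ k, w k ^ 2 - a) ^ 2 ≤ (∑ k, (u k - w k) ^ 2) * (14 / 3 * a) := by linarith
    _ = 14 / (3 * a) * (∑ k, (u k - w k) ^ 2) * a ^ 2 := by field_simp

theorem sum_G1_le {m r : ℕ} {U W : Matrix (Fin m) (Fin r) ℝ} {a : ℝ} (ha : 0 < a)
    (hU : ∀ i, ∑ k, U i k ^ 2 ≤ a) (hW : ∀ i, ∑ k, W i k ^ 2 ≤ 4 / 3 * a) :
    ∑ i, G1 ((∑ k, W i k ^ 2) / a)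
      ≤ Real.exp (1 / 9) * (14 / (3 * a)) * frobNorm (U - W) ^ 2 := by
  rw [frobNorm_sq, Finset.mul_sum]
  refine Finset.sum_le_sum fun i _ => ?_
  rw [mul_assoc]
  exact (G1_le_of_le ((div_le_iff₀ ha).2 (hW i))).trans
    (mul_le_mul_of_nonneg_left (sq_max_div_sub_one_le ha (hU i) (hW i)) (Real.exp_pos _).le)

/-- upper bound on the regularized matrix-completion objective `F̃`. -/
theorem stmt_19 {m n r : ℕ} (hmn : n ≤ m) (hn : 1 ≤ n) (hr : 1 ≤ r)
    (μ₀ ϱ Smax : ℝ) (hμ₀ : 0 < μ₀) (hϱ : 0 < ϱ) (hSmax : 0 ≤ Smax)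
    (Ω : Finset (Fin m × Fin n))
    (U : Matrix (Fin m) (Fin r) ℝ) (V : Matrix (Fin n) (Fin r) ℝ)
    (hU : Uᵀ * U = (m : ℝ) • 1) (hV : Vᵀ * V = (n : ℝ) • 1)
    (hUrow : ∀ i, ∑ k, (U i k) ^ 2 ≤ 3 * μ₀ * r)
    (hVrow : ∀ j, ∑ k, (V j k) ^ 2 ≤ 3 * μ₀ * r)
    (S : Matrix (Fin r) (Fin r) ℝ) (hS : S.IsDiag) (hSbound : ∀ i, |S i i| ≤ Smax) :
    ∀ (W : Matrix (Fin m) (Fin r) ℝ) (Z : Matrix (Fin n) (Fin r) ℝ),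
      Wᵀ * W = (m : ℝ) • 1 → Zᵀ * Z = (n : ℝ) • 1 →
      (∀ i, ∑ k, (W i k) ^ 2 ≤ 4 * μ₀ * r) → (∀ j, ∑ k, (Z j k) ^ 2 ≤ 4 * μ₀ * r) →
      (⨅ S' : Matrix (Fin r) (Fin r) ℝ,
          (1 / 2) * frobNorm (projOmega Ω (U * S * Vᵀ - W * S' * Zᵀ)) ^ 2)
        + ϱ * ∑ i, G1 ((∑ k, (W i k) ^ 2) / (3 * μ₀ * r))
        + ϱ * ∑ j, G1 ((∑ k, (Z j k) ^ 2) / (3 * μ₀ * r))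
      ≤ ((m : ℝ) * Smax ^ 2 + (14 * Real.exp (1 / 9) / (9 * μ₀ * r)) * ϱ)
          * (frobNorm (U - W) ^ 2 + frobNorm (V - Z) ^ 2) := by
  intro W Z hW _ hWrow hZrow
  have hr₀ : (0 : ℝ) < r := by exact_mod_cast hr
  have ha : 0 < 3 * μ₀ * r := by positivity
  have hinf : (⨅ S' : Matrix (Fin r) (Fin r) ℝ,
      (1 / 2) * frobNorm (projOmega Ω (U * S * Vᵀ - W * S' * Zᵀ)) ^ 2)
        ≤ (1 / 2) * frobNorm (projOmega Ω (U * S * Vᵀ - W * S * Zᵀ)) ^ 2 :=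
    ciInf_le ⟨0, by rintro _ ⟨S', rfl⟩; positivity⟩ S
  have hproj := frobNorm_projOmega_sq_le Ω (U * S * Vᵀ - W * S * Zᵀ)
  have hfactor := frobNorm_factor_sub_sq_le (U := U) (Z := Z) hmn hV hW hS hSbound
  have hGW := mul_le_mul_of_nonneg_left
    (sum_G1_le ha hUrow fun i => (hWrow i).trans_eq (by ring)) hϱ.le
  have hGZ := mul_le_mul_of_nonneg_left
    (sum_G1_le ha hVrow fun j => (hZrow j).trans_eq (by ring)) hϱ.le
  have hconst : Real.exp (1 / 9) * (14 / (3 * (3 * μ₀ * r)))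
      = 14 * Real.exp (1 / 9) / (9 * μ₀ * r) := by
    field_simp
    norm_num
  rw [hconst] at hGW hGZ
  linarith
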